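/- Let d ≥ 1 and let 𝓕_1, …, 𝓕_{3d} be nonempty finite families of axis-parallel boxes in ℝ^d such that every colorful 3d-tuple (B_1, …, B_{3d}) with B_i ∈ 𝓕_i is 2-pierceable. Then there exists i ∈ {1,…,3d} and, for every k ∈ {1,…,3d} with k ≠ i, a box F_k ∈ 𝓕_k, such that the extended family 𝓕_i ∪ {F_k : k ∈ {1,…,3d}, k ≠ i} is 2-pierceable. -/

import Mathlib

/-- A family `𝓕` of subsets of `X` is `n`-pierceable if there is a set of at most `n`
points meeting every member of `𝓕`. -/
def Pierceable {X : Type*} (n : ℕ) (𝓕 : Set (Set X)) : Prop :=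
  ∃ P : Finset X, P.card ≤ n ∧ ∀ F ∈ 𝓕, ∃ p ∈ P, p ∈ F

/-- `B` is an axis-parallel box in `ℝ^d`. -/
def IsBox {d : ℕ} (B : Set (Fin d → ℝ)) : Prop :=
  ∃ a b : Fin d → ℝ, (∀ j, a j ≤ b j) ∧ B = Set.Icc a b

/-- `A` is closed under triple sums, that is, an affine subspace of a vector space over
`ZMod 2` (or empty). -/
def TripleClosed {V : Type*} [Add V] (A : Set V) : Prop :=
  ∀ s ∈ A, ∀ t ∈ A, ∀ u ∈ A, s + t + u ∈ A

theorem TripleClosed.inter {V : Type*} [Add V] {A B : Set V} (hA : TripleClosed A)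
    (hB : TripleClosed B) : TripleClosed (A ∩ B) := fun s hs t ht u hu =>
  ⟨hA s hs.1 t ht.1 u hu.1, hB s hs.2 t ht.2 u hu.2⟩

/-- A nonempty proper affine subspace of an affine space over `ZMod 2` has at most half of its
elements. -/
theorem TripleClosed.two_mul_ncard_le {d : ℕ} {A B : Set (Fin d → ZMod 2)} (hA : TripleClosed A)
    (hB : TripleClosed B) (hBA : B ⊂ A) (hne : B.Nonempty) : 2 * B.ncard ≤ A.ncard := by
  obtain ⟨hsub, hnot⟩ := hBA
  obtain ⟨u, huA, huB⟩ := Set.not_subset.1 hnot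
  obtain ⟨v, hv⟩ := hne
  have hinj : Function.Injective fun s : Fin d → ZMod 2 => s + u + v := fun s t h => by
    simpa using h
  have hdisj : Disjoint B ((fun s => s + u + v) '' B) := by
    rw [Set.disjoint_left]
    rintro _ hs ⟨t, ht, rfl⟩
    apply huB
    have h := hB _ hs t ht v hv
    have e : t + u + v + t + v = u := by
      have h2 : ∀ w : Fin d → ZMod 2, w + w = 0 := fun w => by
        ext j
        exact CharTwo.add_self_eq_zero (w j)
      calc t + u + v + t + v = u + (t + t) + (v + v) := by abel
        _ = u := by simp [h2]
    simpa only [e] using h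
  calc 2 * B.ncard = B.ncard + ((fun s => s + u + v) '' B).ncard := by
        rw [Set.ncard_image_of_injective _ hinj, two_mul]
    _ = (B ∪ (fun s => s + u + v) '' B).ncard := (Set.ncard_union_eq hdisj).symm
    _ ≤ A.ncard := by
        refine Set.ncard_le_ncard (Set.union_subset hsub ?_)
        rintro _ ⟨t, ht, rfl⟩
        exact hA t (hsub ht) u huA v (hsub hv)

/-- A strong colorful Helly theorem for affine subspaces of `(ZMod 2)^d` that are invariant under
translation by the all-ones vector. -/
theorem exists_color_forall_mem_of_tripleClosed {d : ℕ} (hd : 1 ≤ d) {ι X : Type*} [DecidableEq ι]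
    (𝓖 : ι → Set X) (C : X → Set (Fin d → ZMod 2)) (hC : ∀ x, TripleClosed (C x))
    (hC1 : ∀ x, ∀ s ∈ C x, s + 1 ∈ C x) (hne : ∀ i, (𝓖 i).Nonempty) (I : Finset ι) :
    ∀ L : Set (Fin d → ZMod 2), TripleClosed L → (∀ s ∈ L, s + 1 ∈ L) → L.ncard ≤ 2 ^ I.card →
      (∀ f : ι → X, (∀ i, f i ∈ 𝓖 i) → ∃ s ∈ L, ∀ i ∈ I, s ∈ C (f i)) →
      ∃ i ∈ I, ∃ f : ι → X, (∀ k, f k ∈ 𝓖 k) ∧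
        ∃ s ∈ L, (∀ k ∈ I, s ∈ C (f k)) ∧ ∀ x ∈ 𝓖 i, s ∈ C x := by
  choose g hg using hne
  induction I using Finset.induction_on with
  | empty =>
    intro L _ hL1 hcard hcol
    obtain ⟨s, hs, -⟩ := hcol g hg
    rw [Finset.card_empty, pow_zero, Set.ncard_le_one] at hcard
    have h := congrFun (hcard s hs (s + 1) (hL1 s hs)) ⟨0, hd⟩
    simp at h
  | insert i I hi ih =>
    intro L hL hL1 hcard hcol
    by_cases h : ∀ x ∈ 𝓖 i, L ⊆ C x
    · obtain ⟨s, hs, hsI⟩ := hcol g hg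
      exact ⟨i, Finset.mem_insert_self i I, g, hg, s, hs, hsI, fun x hx => h x hx hs⟩
    push Not at h
    obtain ⟨x, hx, hnot⟩ := h
    have hcol' : ∀ f : ι → X, (∀ k, f k ∈ 𝓖 k) → ∃ s ∈ L ∩ C x, ∀ k ∈ I, s ∈ C (f k) := by
      intro f hf
      obtain ⟨s, hs, hsI⟩ := hcol (Function.update f i x) (fun k => by
        rcases eq_or_ne k i with rfl | hk
        · simpa using hx
        · simpa [hk] using hf k)
      refine ⟨s, ⟨hs, by simpa using hsI i (Finset.mem_insert_self i I)⟩, fun k hk => ?_⟩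
      have hki : k ≠ i := fun e => hi (e ▸ hk)
      simpa [hki] using hsI k (Finset.mem_insert_of_mem hk)
    have hne : (L ∩ C x).Nonempty := by
      obtain ⟨s, hs, -⟩ := hcol' g hg
      exact ⟨s, hs⟩
    have hhalf := hL.two_mul_ncard_le (hL.inter (hC x))
      ⟨Set.inter_subset_left, fun h => hnot fun s hs => (h hs).2⟩ hne
    rw [Finset.card_insert_of_notMem hi, pow_succ] at hcard
    obtain ⟨i', hi', f, hf, s, hs, hsI, hsi⟩ := ih (L ∩ C x) (hL.inter (hC x))
      (fun s hs => ⟨hL1 s hs.1, hC1 x s hs.2⟩) (by omega) hcol'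
    refine ⟨i', Finset.mem_insert_of_mem hi', Function.update f i x, fun k => ?_, s, hs.1,
      fun k hk => ?_, hsi⟩
    · rcases eq_or_ne k i with rfl | hk
      · simpa using hx
      · simpa [hk] using hf k
    · rcases eq_or_ne k i with rfl | hki
      · simpa using hs.2
      · simpa [hki] using hsI k ((Finset.mem_insert.1 hk).resolve_left hki)

/-- Given finite colored families and fewer functionals `φ` than colors, one can choose at most
one element of each color, and at most as many elements as there are functionals, so that each
functional is at least as small on a chosen element as on all elements of unused colors. -/
theorem exists_dominating_choice {ι X D : Type*} [Fintype ι] [DecidableEq ι]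
    (𝓖 : ι → Set X) (hfin : ∀ i, (𝓖 i).Finite) (hne : ∀ i, (𝓖 i).Nonempty)
    (φ : D → X → ℝ) (T : Finset D) :
    T.card < Fintype.card ι → ∃ S : Finset ι, S.card ≤ T.card ∧ ∃ R : ι → X, (∀ i, R i ∈ 𝓖 i) ∧
      ∀ t ∈ T, ∃ k ∈ S, ∀ k' ∉ S, ∀ x ∈ 𝓖 k', φ t (R k) ≤ φ t x := by
  classical
  choose g hg using hne
  induction T using Finset.induction_on with
  | empty => exact fun _ => ⟨∅, le_rfl, g, hg, by simp⟩
  | insert t T ht ih =>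
    intro hlt
    rw [Finset.card_insert_of_notMem ht] at hlt ⊢
    obtain ⟨S, hS, R, hR, hdom⟩ := ih (by omega)
    obtain ⟨k₀, hk₀⟩ : ∃ k, k ∉ S := by
      by_contra! h
      have := Finset.card_eq_iff_eq_univ S |>.2 (Finset.eq_univ_of_forall h)
      omega
    have hUfin : (⋃ k ∈ {k | k ∉ S}, 𝓖 k).Finite :=
      (Set.toFinite {k | k ∉ S}).biUnion fun k _ => hfin k
    obtain ⟨y, hy, hmin⟩ := Set.exists_min_image _ (φ t) hUfin
      ⟨g k₀, Set.mem_biUnion hk₀ (hg k₀)⟩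
    obtain ⟨i, hi, hyi⟩ := Set.mem_iUnion₂.1 hy
    refine ⟨insert i S, by rw [Finset.card_insert_of_notMem hi]; omega, Function.update R i y,
      fun k => ?_, fun t' ht' => ?_⟩
    · rcases eq_or_ne k i with rfl | hk
      · simpa using hyi
      · simpa [hk] using hR k
    · rcases Finset.mem_insert.1 ht' with rfl | ht'
      · refine ⟨i, Finset.mem_insert_self i S, fun k' hk' x hx => ?_⟩
        rw [Function.update_self]
        exact hmin x (Set.mem_biUnion (fun h => hk' (Finset.mem_insert_of_mem h)) hx)
      · obtain ⟨k, hk, h⟩ := hdom t' ht'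
        have hki : k ≠ i := fun e => hi (e ▸ hk)
        refine ⟨k, Finset.mem_insert_of_mem hk, fun k' hk' x hx => ?_⟩
        rw [Function.update_of_ne hki]
        exact h k' (fun h => hk' (Finset.mem_insert_of_mem h)) x hx

/-- The vertex, selected by `s`, of the box spanned by `a` and `a ⊔ b`. -/
noncomputable def boxVertex {d : ℕ} (a b : Fin d → ℝ) (s : Fin d → ZMod 2) : Fin d → ℝ :=
  fun j => if s j = 0 then a j else max (a j) (b j)

/-- The selectors `s` such that `B` contains the vertex selected by `s` or the opposite one. -/
def piercingSelectors {d : ℕ} (a b : Fin d → ℝ) (B : Set (Fin d → ℝ)) : Set (Fin d → ZMod 2) :=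
  {s | boxVertex a b s ∈ B ∨ boxVertex a b (s + 1) ∈ B}

theorem boxVertex_triple_mem_Icc {d : ℕ} {a b l h : Fin d → ℝ} {s t u : Fin d → ZMod 2}
    (hs : boxVertex a b s ∈ Set.Icc l h) (ht : boxVertex a b t ∈ Set.Icc l h)
    (hu : boxVertex a b u ∈ Set.Icc l h) : boxVertex a b (s + t + u) ∈ Set.Icc l h := by
  have key : ∀ x y z : ZMod 2, x + y + z = x ∨ x + y + z = y ∨ x + y + z = z := by decide
  have hj : ∀ j, boxVertex a b (s + t + u) j ∈ Set.Icc (l j) (h j) := fun j => by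
    rcases key (s j) (t j) (u j) with e | e | e
    · simpa [boxVertex, e] using And.intro (hs.1 j) (hs.2 j)
    · simpa [boxVertex, e] using And.intro (ht.1 j) (ht.2 j)
    · simpa [boxVertex, e] using And.intro (hu.1 j) (hu.2 j)
  exact ⟨fun j => (hj j).1, fun j => (hj j).2⟩

theorem selector_add_one_add_one {d : ℕ} (s : Fin d → ZMod 2) : s + 1 + 1 = s := by
  ext j
  simp [add_assoc, CharTwo.add_self_eq_zero]

theorem add_one_mem_piercingSelectors {d : ℕ} {a b : Fin d → ℝ} {B : Set (Fin d → ℝ)}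
    {s : Fin d → ZMod 2} (hs : s ∈ piercingSelectors a b B) :
    s + 1 ∈ piercingSelectors a b B := by
  change _ ∨ boxVertex a b (s + 1 + 1) ∈ B
  rw [selector_add_one_add_one]
  exact hs.symm

theorem tripleClosed_piercingSelectors {d : ℕ} (a b l h : Fin d → ℝ) :
    TripleClosed (piercingSelectors a b (Set.Icc l h)) := by
  have e1 : ∀ s t u : Fin d → ZMod 2, s + t + (u + 1) = s + t + u + 1 := fun s t u => by abel
  have e2 : ∀ s t u : Fin d → ZMod 2, s + (t + 1) + u = s + t + u + 1 := fun s t u => by abel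
  have e3 : ∀ s t u : Fin d → ZMod 2, s + 1 + t + u = s + t + u + 1 := fun s t u => by abel
  rintro s (hs | hs) t (ht | ht) u (hu | hu) <;>
  · have := boxVertex_triple_mem_Icc hs ht hu
    try simp only [e1, e2, e3, selector_add_one_add_one] at this
    first
      | exact Or.inl this
      | exact Or.inr this

/-- If two points pierce, in each coordinate `j`, both a box lying below `a j` and a box lying
above `b j`, then they can be moved to opposite vertices without leaving any box that reaches
up to `a` and down to `b`. -/
theorem exists_selector_forall_mem {d : ℕ} {a b p q : Fin d → ℝ}
    (hA : ∀ j, p j ≤ a j ∨ q j ≤ a j) (hB : ∀ j, b j ≤ p j ∨ b j ≤ q j) :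
    ∃ s, ∀ l h : Fin d → ℝ, a ≤ h → l ≤ b → p ∈ Set.Icc l h ∨ q ∈ Set.Icc l h →
      s ∈ piercingSelectors a b (Set.Icc l h) := by
  classical
  refine ⟨fun j => if p j ≤ a j then 0 else 1, fun l h ha hb hpq => ?_⟩
  refine hpq.imp (fun hp => ?_) fun hq => ?_
  all_goals
    rw [← Set.pi_univ_Icc]
    intro j _
    have haj := ha j
    have hbj := hb j
    have hAj := hA j
    have hBj := hB j
  · have h1 := hp.1 j
    have h2 := hp.2 j
    by_cases hpa : p j ≤ a j
    · simp only [boxVertex, hpa, if_true, Set.mem_Icc]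
      constructor <;> linarith
    · simp only [boxVertex, hpa, if_false, one_ne_zero, Set.mem_Icc]
      refine ⟨hbj.trans (le_max_right _ _), max_le haj ?_⟩
      rcases hAj with h | h
      · exact absurd h hpa
      · rcases hBj with h' | h' <;> linarith
  · have h1 := hq.1 j
    have h2 := hq.2 j
    by_cases hpa : p j ≤ a j
    · simp only [boxVertex, hpa, if_true, Pi.add_apply, Pi.one_apply, zero_add, one_ne_zero,
        if_false, Set.mem_Icc]
      refine ⟨hbj.trans (le_max_right _ _), max_le haj ?_⟩
      rcases hBj with h' | h' <;> linarith
    · have e : (1 : ZMod 2) + 1 = 0 := by decide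
      simp only [boxVertex, hpa, if_false, Pi.add_apply, Pi.one_apply, e, if_true, Set.mem_Icc]
      refine ⟨?_, haj⟩
      rcases hAj with h | h
      · exact absurd h hpa
      · linarith

theorem Pierceable.exists_pair {X : Type*} [Nonempty X] {𝓕 : Set (Set X)} (h : Pierceable 2 𝓕) :
    ∃ p q, ∀ F ∈ 𝓕, p ∈ F ∨ q ∈ F := by
  classical
  obtain ⟨P, hP, hpierce⟩ := h
  obtain ⟨p, q, hPpq⟩ : ∃ p q, P ⊆ {p, q} := by
    interval_cases hc : P.card
    · obtain ⟨x⟩ := ‹Nonempty X›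
      exact ⟨x, x, by simp [Finset.card_eq_zero.1 hc]⟩
    · obtain ⟨x, rfl⟩ := Finset.card_eq_one.1 hc
      exact ⟨x, x, by simp⟩
    · obtain ⟨x, y, -, rfl⟩ := Finset.card_eq_two.1 hc
      exact ⟨x, y, subset_rfl⟩
  refine ⟨p, q, fun F hF => ?_⟩
  obtain ⟨x, hx, hxF⟩ := hpierce F hF
  have := hPpq hx
  simp only [Finset.mem_insert, Finset.mem_singleton] at this
  rcases this with rfl | rfl
  · exact Or.inl hxF
  · exact Or.inr hxF

/-- Strong colorful Helly theorem for `2`-piercing of axis-parallel boxes in `ℝ^d`: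
if every colorful `3d`-tuple from the nonempty finite families `𝓕 0, …, 𝓕 (3d-1)` of
axis-parallel boxes is `2`-pierceable, then there is an `i` and a choice of one box
`F k ∈ 𝓕 k` for every `k ≠ i` such that `𝓕 i` together with these chosen boxes is
`2`-pierceable. -/
theorem strong_colorful_helly_boxes_two_piercing (d : ℕ) (hd : 1 ≤ d)
    (𝓕 : Fin (3 * d) → Set (Set (Fin d → ℝ)))
    (hfin : ∀ i, (𝓕 i).Finite)
    (hne : ∀ i, (𝓕 i).Nonempty)
    (hbox : ∀ i, ∀ B ∈ 𝓕 i, IsBox B)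
    (hcol : ∀ f : Fin (3 * d) → Set (Fin d → ℝ), (∀ i, f i ∈ 𝓕 i) →
      Pierceable 2 {B | ∃ i, B = f i}) :
    ∃ i : Fin (3 * d), ∃ F : Fin (3 * d) → Set (Fin d → ℝ),
      (∀ k, k ≠ i → F k ∈ 𝓕 k) ∧
      Pierceable 2 (𝓕 i ∪ {B | ∃ k, k ≠ i ∧ B = F k}) := by
  classical
  have hIcc : ∀ B : Set (Fin d → ℝ), ∃ l h : Fin d → ℝ, IsBox B → B = Set.Icc l h := fun B => by
    by_cases hB : IsBox B
    · obtain ⟨l, h, -, e⟩ := hB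
      exact ⟨l, h, fun _ => e⟩
    · exact ⟨0, 0, fun h => absurd h hB⟩
  choose lo hi hlh using hIcc
  have heq : ∀ i, ∀ B ∈ 𝓕 i, B = Set.Icc (lo B) (hi B) := fun i B hB => hlh B (hbox i B hB)
  obtain ⟨S, hScard, R, hR, hdom⟩ := exists_dominating_choice 𝓕 hfin hne
    (fun (t : Fin d ⊕ Fin d) B => t.elim (fun j => hi B j) (fun j => -lo B j)) Finset.univ
    (by simp; omega)
  have hSne : S.Nonempty := by
    obtain ⟨k, hk, -⟩ := hdom (Sum.inl ⟨0, hd⟩) (Finset.mem_univ _)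
    exact ⟨k, hk⟩
  choose α hα hαmin using fun j => S.exists_min_image (fun k => hi (R k) j) hSne
  choose β hβ hβmax using fun j => S.exists_max_image (fun k => lo (R k) j) hSne
  set a : Fin d → ℝ := fun j => hi (R (α j)) j
  set b : Fin d → ℝ := fun j => lo (R (β j)) j
  have hRa : ∀ k ∈ S, a ≤ hi (R k) := fun k hk j => hαmin j k hk
  have hRb : ∀ k ∈ S, lo (R k) ≤ b := fun k hk j => hβmax j k hk
  have hFa : ∀ k ∉ S, ∀ B ∈ 𝓕 k, a ≤ hi B := fun k hk B hB j => by
    obtain ⟨k', hk', h⟩ := hdom (Sum.inl j) (Finset.mem_univ _)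
    exact (hαmin j k' hk').trans (h k hk B hB)
  have hFb : ∀ k ∉ S, ∀ B ∈ 𝓕 k, lo B ≤ b := fun k hk B hB j => by
    obtain ⟨k', hk', h⟩ := hdom (Sum.inr j) (Finset.mem_univ _)
    exact (neg_le_neg_iff.1 (h k hk B hB)).trans (hβmax j k' hk')
  set C : Set (Fin d → ℝ) → Set (Fin d → ZMod 2) :=
    fun B => piercingSelectors a b (Set.Icc (lo B) (hi B))
  have hCtriple : ∀ B, TripleClosed (C B) := fun B => tripleClosed_piercingSelectors a b _ _
  set L : Set (Fin d → ZMod 2) := {s | ∀ k ∈ S, s ∈ C (R k)}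
  have hLcard : L.ncard ≤ 2 ^ Sᶜ.card := by
    calc L.ncard ≤ Nat.card (Fin d → ZMod 2) := Set.ncard_le_card L
      _ = 2 ^ d := by simp
      _ ≤ 2 ^ Sᶜ.card := by
        refine Nat.pow_le_pow_right two_pos ?_
        rw [Finset.card_compl]
        simp at hScard ⊢
        omega
  have hmix : ∀ f : Fin (3 * d) → Set (Fin d → ℝ), (∀ i, f i ∈ 𝓕 i) →
      ∀ k, (if k ∈ S then R k else f k) ∈ 𝓕 k := fun f hf k => by
    split_ifs
    exacts [hR k, hf k]
  have hcolL : ∀ f : Fin (3 * d) → Set (Fin d → ℝ), (∀ i, f i ∈ 𝓕 i) →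
      ∃ s ∈ L, ∀ i ∈ Sᶜ, s ∈ C (f i) := by
    intro f hf
    obtain ⟨p, q, hpq⟩ := (hcol (fun k => if k ∈ S then R k else f k) (hmix f hf)).exists_pair
    have hpqR : ∀ k ∈ S, p ∈ Set.Icc (lo (R k)) (hi (R k)) ∨ q ∈ Set.Icc (lo (R k)) (hi (R k)) :=
      fun k hk => by
        rw [← heq k _ (hR k)]
        exact hpq _ ⟨k, by simp [hk]⟩
    have hpqf : ∀ k ∉ S, p ∈ Set.Icc (lo (f k)) (hi (f k)) ∨ q ∈ Set.Icc (lo (f k)) (hi (f k)) :=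
      fun k hk => by
        rw [← heq k _ (hf k)]
        exact hpq _ ⟨k, by simp [hk]⟩
    obtain ⟨s, hs⟩ := exists_selector_forall_mem (a := a) (b := b)
      (fun j => (hpqR _ (hα j)).imp (fun h => h.2 j) fun h => h.2 j)
      (fun j => (hpqR _ (hβ j)).imp (fun h => h.1 j) fun h => h.1 j)
    refine ⟨s, fun k hk => hs _ _ (hRa k hk) (hRb k hk) (hpqR k hk), fun k hk => ?_⟩
    have hk' : k ∉ S := Finset.mem_compl.1 hk
    exact hs _ _ (hFa k hk' _ (hf k)) (hFb k hk' _ (hf k)) (hpqf k hk')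
  obtain ⟨i, -, f, hf, s, hsL, hsf, hsi⟩ := exists_color_forall_mem_of_tripleClosed hd 𝓕 C hCtriple
    (fun B s hs => add_one_mem_piercingSelectors hs) hne Sᶜ L
    (fun s hs t ht u hu k hk => hCtriple _ s (hs k hk) t (ht k hk) u (hu k hk))
    (fun s hs k hk => add_one_mem_piercingSelectors (hs k hk)) hLcard hcolL
  have hpierce : ∀ k, ∀ B ∈ 𝓕 k, s ∈ C B →
      ∃ p ∈ ({boxVertex a b s, boxVertex a b (s + 1)} : Finset (Fin d → ℝ)), p ∈ B := by
    intro k B hB hs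
    rw [heq k B hB]
    rcases hs with h | h
    · exact ⟨_, by simp, h⟩
    · exact ⟨_, by simp, h⟩
  refine ⟨i, fun k => if k ∈ S then R k else f k, fun k _ => hmix f hf k,
    {boxVertex a b s, boxVertex a b (s + 1)}, Finset.card_le_two, ?_⟩
  rintro B (hB | ⟨k, -, rfl⟩)
  · exact hpierce i B hB (hsi B hB)
  · beta_reduce
    split_ifs with hk
    · exact hpierce k _ (hR k) (hsL k hk)
    · exact hpierce k _ (hf k) (hsf k (Finset.mem_compl.2 hk))
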